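/- arXiv:2105.05505 — 19 statements merged into one kernel-verified Lean document; each statement's English description precedes it below -/
import Mathlib

section
/- Let (Q,+) be a group, let φ, ψ, α, β be automorphisms of (Q,+), and let a, b ∈ Q. Define x∘y = φ(x) + a + ψ(y) and x*y = α(x) + b + β(y). Then the identity (x∘z)*(y∘z) = x*y holds for all x, y, z ∈ Q if and only if (Q,+) is commutative, φ is the identity map, and β(y) = −α(y) for all y ∈ Q (so that x∘y = x + ψ(y) + a and x*y = α(x) − α(y) + b). -/
/-- A biquasigroup linear over a group `(Q,+)` (with `x∘y = φ x + a + ψ y`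
and `x*y = α x + b + β y`) satisfies `(x∘z)*(y∘z) = x*y` for all `x,y,z` iff `(Q,+)` is
commutative, `φ` is the identity and `β = -α`. -/
theorem stmt_0 {Q : Type*} [AddGroup Q] (φ ψ α β : AddAut Q) (a b : Q)
    (circ star : Q → Q → Q)
    (hcirc : ∀ x y, circ x y = φ x + a + ψ y)
    (hstar : ∀ x y, star x y = α x + b + β y) :
    (∀ x y z, star (circ x z) (circ y z) = star x y) ↔
      ((∀ x y : Q, x + y = y + x) ∧ (∀ x, φ x = x) ∧ (∀ y, β y = -(α y))) := by
  constructor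
  · intro h
    simp only [hcirc, hstar, map_add] at h
    have hzero : α a + b + β a = b := by simpa using h 0 0 0
    have hφ : ∀ x, φ x = x := by
      intro x
      have hx : α (φ x) + (α a + b + β a) = α x + b := by
        simpa [add_assoc] using h x 0 0
      rw [hzero] at hx
      exact α.injective (add_right_cancel hx)
    have key : ∀ u c, α u + c + β u = c := by
      intro u c
      obtain ⟨z, hz⟩ := ψ.surjective (-a + u)
      obtain ⟨y, hy⟩ := β.surjective (-b + c)
      have hyz := h 0 y z
      have hu : a + ψ z = u := by rw [hz, add_neg_cancel_left]
      have hc : b + β y = c := by rw [hy, add_neg_cancel_left]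
      rw [← hu, ← hc, map_add, map_add]
      simpa [hφ, add_assoc] using hyz
    have hβ : ∀ u, β u = -(α u) := fun u =>
      (neg_eq_of_add_eq_zero_right (by simpa using key u 0)).symm
    refine ⟨fun x y => ?_, hφ, hβ⟩
    obtain ⟨u, rfl⟩ := α.surjective x
    have hy := key u y
    rwa [hβ, ← sub_eq_add_neg, sub_eq_iff_eq_add] at hy
  · rintro ⟨hcomm, hφ, hβ⟩ x y z
    let _ : AddCommGroup Q := { (inferInstance : AddGroup Q) with add_comm := hcomm }
    simp only [hcirc, hstar, hφ, hβ, map_add]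
    abel
end

section
/- Let (Q,+) be a group, let φ, ψ be automorphisms of (Q,+), and let a ∈ Q. Define x∘y = φ(x) + a + ψ(y). Then the identity (x∘z)∘(y∘z) = x∘y holds for all x, y, z ∈ Q if and only if (Q,+) is commutative, φ is the identity map, and ψ(y) = −y for all y ∈ Q (so that x∘y = x − y + a). -/
/-- A quasigroup linear over a group `(Q,+)` (with `x∘y = φ x + a + ψ y`)
satisfies `(x∘z)∘(y∘z) = x∘y` for all `x,y,z` iff `(Q,+)` is commutative, `φ` is the
identity and `ψ y = -y` for all `y`. -/
theorem stmt_1 {Q : Type*} [AddGroup Q] (φ ψ : AddAut Q) (a : Q)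
    (circ : Q → Q → Q)
    (hcirc : ∀ x y, circ x y = φ x + a + ψ y) :
    (∀ x y z, circ (circ x z) (circ y z) = circ x y) ↔
      ((∀ x y : Q, x + y = y + x) ∧ (∀ x, φ x = x) ∧ (∀ y, ψ y = -y)) := by
  constructor
  · intro h
    simp only [hcirc, map_add] at h
    have ha : φ a + a + ψ a = a := by simpa [add_assoc] using h 0 0 0
    have hφ : ∀ x, φ x = x := by
      intro x
      have hx : φ (φ x) + (φ a + a + ψ a) = φ x + a := by
        simpa [add_assoc] using h x 0 0
      rw [ha] at hx
      exact φ.injective (add_right_cancel hx)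
    simp only [hφ] at h ha
    have hψa : a + ψ a = 0 := by simpa [add_assoc] using ha
    have hψ : ∀ y, ψ y = -y := by
      intro y
      have hy : ψ y + (a + ψ a) + ψ (ψ y) = 0 := by
        simpa [add_assoc] using h 0 0 y
      rw [hψa, add_zero, ← map_add] at hy
      exact (neg_eq_of_add_eq_zero_right (ψ.injective (hy.trans (map_zero ψ).symm))).symm
    refine ⟨fun x y => ?_, hφ, hψ⟩
    have hxy := map_add ψ y x
    simp only [hψ, ← neg_add_rev] at hxy
    exact (neg_injective hxy).symm
  · rintro ⟨hcomm, hφ, hψ⟩ x y z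
    let _ : AddCommGroup Q := { ‹AddGroup Q› with add_comm := hcomm }
    simp only [hcirc, hφ, hψ]
    abel
end

section
/- If a biquasigroup (Q,∘,*) satisfies the identity (x∘z)∘(y∘z) = x*y for all x, y, z ∈ Q, then both operations are unipotent with a common value: there exists q ∈ Q such that x∘x = q = x*x for all x ∈ Q, and moreover x*y = (x∘y)∘q = q∘(y∘x) for all x, y ∈ Q. -/
/-- If a biquasigroup `(Q,∘,*)` satisfies `(x∘z)∘(y∘z) = x*y`, then both
operations are unipotent with a common value `q`, and `x*y = (x∘y)∘q = q∘(y∘x)`. -/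
theorem stmt_2 {Q : Type*} [Nonempty Q] (circ star : Q → Q → Q)
    (hcl : ∀ a : Q, Function.Bijective (fun x => circ a x))
    (hcr : ∀ a : Q, Function.Bijective (fun x => circ x a))
    (hsl : ∀ a : Q, Function.Bijective (fun x => star a x))
    (hsr : ∀ a : Q, Function.Bijective (fun x => star x a))
    (hid : ∀ x y z, circ (circ x z) (circ y z) = star x y) :
    ∃ q : Q, (∀ x, circ x x = q ∧ star x x = q) ∧
      (∀ x y, star x y = circ (circ x y) q ∧ star x y = circ q (circ y x)) := by
  have hsq : ∀ x w, circ w w = star x x := by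
    intro x w
    obtain ⟨z, rfl⟩ := (hcl x).2 w
    exact hid x x z
  obtain ⟨a⟩ := ‹Nonempty Q›
  have hc : ∀ x, circ x x = star a a := hsq a
  refine ⟨star a a, fun x => ⟨hc x, (hsq x a).symm.trans (hc a)⟩, fun x y => ⟨?_, ?_⟩⟩
  · rw [← hid x y y, hc y]
  · rw [← hid x y x, hc x]
end

section
/- Let ∘ be a medial unipotent quasigroup operation on Q, with x∘x = q for all x ∈ Q, and define x*y = (x∘y)∘q. Then * is a quasigroup operation on Q and the identity (x∘z)∘(y∘z) = x*y holds for all x, y, z ∈ Q. Moreover, if q is a left neutral element of ∘ (i.e. q∘x = x for all x), then x*y = y∘x for all x, y ∈ Q. -/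
/-- If `∘` is a medial unipotent quasigroup operation on `Q` with `x∘x = q`,
and `x*y = (x∘y)∘q`, then `*` is a quasigroup operation, the identity
`(x∘z)∘(y∘z) = x*y` holds, and if `q` is a left neutral element of `∘` then `x*y = y∘x`. -/
theorem stmt_3 {Q : Type*} [Nonempty Q] (circ star : Q → Q → Q) (q : Q)
    (hcl : ∀ a : Q, Function.Bijective (fun x => circ a x))
    (hcr : ∀ a : Q, Function.Bijective (fun x => circ x a))
    (hmed : ∀ x y z w, circ (circ x y) (circ z w) = circ (circ x z) (circ y w))
    (huni : ∀ x, circ x x = q)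
    (hstar : ∀ x y, star x y = circ (circ x y) q) :
    ((∀ a : Q, Function.Bijective (fun x => star a x)) ∧
      (∀ a : Q, Function.Bijective (fun x => star x a))) ∧
    (∀ x y z, circ (circ x z) (circ y z) = star x y) ∧
    ((∀ x, circ q x = x) → ∀ x y, star x y = circ y x) := by
  obtain rfl : star = fun x y => circ (circ x y) q := funext₂ hstar
  refine ⟨⟨fun a => (hcr q).comp (hcl a), fun a => (hcr q).comp (hcr a)⟩,
    fun x y z => ?_, fun hq x y => ?_⟩
  · simp only [hmed x z y z, huni z]
  · calc circ (circ x y) q = circ (circ x y) (circ x x) := by rw [huni x]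
      _ = circ (circ x x) (circ y x) := hmed x y x x
      _ = circ y x := by rw [huni x, hq]
end

section
/- Let (Q,+) be a group, let φ, ψ, α, β be automorphisms of (Q,+), and let a, b ∈ Q. Define x∘y = φ(x) + a + ψ(y) and x*y = α(x) + b + β(y). Then the identity (x∘z)∘(y∘z) = x*y holds for all x, y, z ∈ Q if and only if (Q,+) is commutative, ψ = −φ, α = φ², β = −φ², and b = a (so that x∘y = φ(x) + a − φ(y) and x*y = φ²(x) + a − φ²(y)). -/
/-- A biquasigroup linear over a group `(Q,+)` satisfies
`(x∘z)∘(y∘z) = x*y` iff `(Q,+)` is commutative, `ψ = -φ`, `α = φ²`, `β = -φ²` and `b = a`. -/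
theorem stmt_4 {Q : Type*} [AddGroup Q] (φ ψ α β : AddAut Q) (a b : Q)
    (circ star : Q → Q → Q)
    (hcirc : ∀ x y, circ x y = φ x + a + ψ y)
    (hstar : ∀ x y, star x y = α x + b + β y) :
    (∀ x y z, circ (circ x z) (circ y z) = star x y) ↔
      ((∀ x y : Q, x + y = y + x) ∧ (∀ y, ψ y = -(φ y)) ∧
        (∀ x, α x = φ (φ x)) ∧ (∀ y, β y = -(φ (φ y))) ∧ b = a) := by
  simp only [hcirc, hstar, map_add]
  constructor
  · intro h
    have h0 : φ a + a + ψ a = b := by simpa using h 0 0 0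
    have hα : ∀ x, α x = φ (φ x) := fun x => by
      have hx := h x 0 0
      simp only [map_zero, add_zero, zero_add] at hx
      rw [← h0] at hx
      simpa [add_assoc] using hx.symm
    have hβ : ∀ y, φ a + a + (ψ (φ y) + ψ a) = b + β y := fun y => by
      simpa using h 0 y 0
    have hz : ∀ u z, φ (ψ z) + u + ψ (ψ z) = u := fun u z => by
      obtain ⟨y, hy⟩ : ∃ y, ψ (φ y) = -a + u - ψ a :=
        ⟨φ.symm (ψ.symm (-a + u - ψ a)), by simp⟩
      have hyz := h 0 y z
      simp only [map_zero, zero_add] at hyz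
      rw [← hβ, hy] at hyz
      simpa [add_assoc, sub_eq_add_neg] using hyz
    have hneg : ∀ y, ψ y = -(φ y) := fun y => by
      have hy := hz 0 (ψ.symm y)
      rw [add_zero, AddEquiv.apply_symm_apply] at hy
      exact (neg_eq_of_add_eq_zero_right hy).symm
    have hcomm : ∀ x y : Q, x + y = y + x := fun x y => by
      obtain ⟨z, rfl⟩ : ∃ z, φ (ψ z) = x := ⟨ψ.symm (φ.symm x), by simp⟩
      have hy := hz y z
      rwa [hneg (ψ z), ← sub_eq_add_neg, sub_eq_iff_eq_add] at hy
    have hb : b = a := by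
      rw [← h0, hneg a, hcomm (φ a) a, add_neg_cancel_right]
    refine ⟨hcomm, hneg, hα, fun y => ?_, hb⟩
    have hy := hβ y
    rw [hcomm (ψ (φ y)), ← add_assoc, h0] at hy
    rw [← add_left_cancel hy, hneg]
  · rintro ⟨hcomm, hψ, hα, hβ, rfl⟩ x y z
    simp only [hψ, hα, hβ, map_neg, neg_neg]
    let _ : AddCommGroup Q := { ‹AddGroup Q› with add_comm := hcomm }
    have key : ∀ p q r s t : Q, p + s + -r + t + (-q + -s + r) = p + t + -q :=
      fun p q r s t => by abel
    simpa [neg_add] using key (φ (φ x)) (φ (φ y)) (φ (φ z)) (φ b) b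
end

section
/- If a biquasigroup (Q,∘,*) satisfies the identity (x∘z)∘(y*z) = x∘y for all x, y, z ∈ Q, then there exists e ∈ Q such that x∘e = x, x*e = x and x*x = e for all x ∈ Q (so e is a common right neutral element of both operations and (Q,*) is unipotent); moreover e is the unique idempotent of each operation: for every a ∈ Q, if a∘a = a then a = e, and if a*a = a then a = e. -/
/-- If a biquasigroup `(Q,∘,*)` satisfies `(x∘z)∘(y*z) = x∘y`, then there
is `e ∈ Q` which is a common right neutral element of both operations, with `x*x = e`
for all `x`, and `e` is the unique idempotent of each operation. -/
theorem stmt_5 {Q : Type*} [Nonempty Q] (circ star : Q → Q → Q)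
    (hcl : ∀ a : Q, Function.Bijective (fun x => circ a x))
    (hcr : ∀ a : Q, Function.Bijective (fun x => circ x a))
    (hsl : ∀ a : Q, Function.Bijective (fun x => star a x))
    (hsr : ∀ a : Q, Function.Bijective (fun x => star x a))
    (hid : ∀ x y z, circ (circ x z) (star y z) = circ x y) :
    ∃ e : Q, (∀ x, circ x e = x ∧ star x e = x ∧ star x x = e) ∧
      (∀ a, circ a a = a → a = e) ∧ (∀ a, star a a = a → a = e) := by
  obtain ⟨a⟩ := ‹Nonempty Q›
  have circ_right_e : ∀ x, circ x (star a a) = x := by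
    intro x
    obtain ⟨w, rfl⟩ := (hcr a).surjective x
    exact hid w a a
  have star_self : ∀ x, star x x = star a a := fun x =>
    (hcl (circ x x)).injective ((hid x x x).trans (circ_right_e _).symm)
  have star_right_e : ∀ x, star x (star a a) = x := by
    intro x
    have h := hid x x (star a a)
    rw [circ_right_e] at h
    exact (hcl x).injective h
  exact ⟨star a a, fun x => ⟨circ_right_e x, star_right_e x, star_self x⟩,
    fun b hb => (hcl b).injective (hb.trans (circ_right_e b).symm),
    fun b hb => hb.symm.trans (star_self b)⟩
end

section
/- Let (Q,∘,*) be a biquasigroup satisfying the identity (x∘z)∘(y*z) = x∘y for all x, y, z ∈ Q. If the operation ∘ is medial and unipotent, then the two operations coincide: x∘y = x*y for all x, y ∈ Q. -/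
/-- If a biquasigroup `(Q,∘,*)` satisfies `(x∘z)∘(y*z) = x∘y` and `∘` is
medial and unipotent, then the two operations coincide. -/
theorem stmt_7 {Q : Type*} [Nonempty Q] (circ star : Q → Q → Q)
    (hcl : ∀ a : Q, Function.Bijective (fun x => circ a x))
    (hcr : ∀ a : Q, Function.Bijective (fun x => circ x a))
    (hsl : ∀ a : Q, Function.Bijective (fun x => star a x))
    (hsr : ∀ a : Q, Function.Bijective (fun x => star x a))
    (hid : ∀ x y z, circ (circ x z) (star y z) = circ x y)
    (hmed : ∀ x y z w, circ (circ x y) (circ z w) = circ (circ x z) (circ y w))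
    (huni : ∃ q : Q, ∀ x, circ x x = q) :
    ∀ x y, circ x y = star x y := by
  obtain ⟨q, hq⟩ := huni
  intro x y
  refine (hcl (circ x y)).injective ?_
  rw [hid x x y, hq, hq]
end

section
/- Let (Q,+) be a group, let φ, ψ, α, β be automorphisms of (Q,+), and let a, b ∈ Q. Define x∘y = φ(x) + a + ψ(y) and x*y = α(x) + b + β(y). Then the identity (x∘z)∘(y*z) = x∘y holds for all x, y, z ∈ Q if and only if (Q,+) is commutative, φ and α are the identity map, β(y) = −y for all y, and a = −ψ(b) (so that x∘y = x + ψ(y) − ψ(b) and x*y = x − y + b). -/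
/-- A biquasigroup linear over a group `(Q,+)` satisfies
`(x∘z)∘(y*z) = x∘y` iff `(Q,+)` is commutative, `φ = α = id`, `β y = -y` and `a = -ψ b`. -/
theorem stmt_8 {Q : Type*} [AddGroup Q] (φ ψ α β : AddAut Q) (a b : Q)
    (circ star : Q → Q → Q)
    (hcirc : ∀ x y, circ x y = φ x + a + ψ y)
    (hstar : ∀ x y, star x y = α x + b + β y) :
    (∀ x y z, circ (circ x z) (star y z) = circ x y) ↔
      ((∀ x y : Q, x + y = y + x) ∧ (∀ x, φ x = x) ∧ (∀ x, α x = x) ∧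
        (∀ y, β y = -y) ∧ a = -(ψ b)) := by
  simp only [hcirc, hstar, map_add]
  constructor
  · intro h
    have h0 : φ a + a + ψ b = a := by simpa using h 0 0 0
    have hφ : ∀ x, φ x = x := fun x ↦ by
      have hx : φ (φ x) + φ a + a + ψ b = φ x + a := by simpa using h x 0 0
      have hx' : φ (φ x) + (φ a + a + ψ b) = φ x + a := by rw [← hx]; simp only [add_assoc]
      rw [h0] at hx'
      exact φ.injective (add_right_cancel hx')
    have ha : a + ψ b = 0 := by
      rw [hφ, add_assoc] at h0
      simpa using h0
    have hb : ψ b = -a := (neg_eq_of_add_eq_zero_right ha).symm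
    have key : ∀ y z, ψ z + (a + (ψ (α y) + (-a + ψ (β z)))) = ψ y := fun y z ↦ by
      have hyz := h 0 y z
      simpa only [hφ, hb, zero_add, add_assoc, add_right_inj] using hyz
    have hβ : ∀ z, β z = -z := fun z ↦ by
      have hz : ψ z + ψ (β z) = 0 := by simpa using key 0 z
      rw [← map_add, EmbeddingLike.map_eq_zero_iff] at hz
      exact (neg_eq_of_add_eq_zero_right hz).symm
    have hcomm : ∀ x y : Q, x + y = y + x := fun x y ↦ by
      have hxy := map_add β x y
      rw [hβ, hβ, hβ, ← neg_add_rev] at hxy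
      exact neg_injective hxy
    refine ⟨hcomm, hφ, fun y ↦ ψ.injective ?_, hβ, by rw [hb, neg_neg]⟩
    have hy : a + (ψ (α y) + -a) = ψ y := by simpa using key y 0
    rwa [hcomm (ψ (α y)), add_neg_cancel_left] at hy
  · rintro ⟨hcomm, hφ, hα, hβ, rfl⟩ x y z
    let _ : AddCommGroup Q := { ‹AddGroup Q› with add_comm := hcomm }
    simp only [hφ, hα, hβ, map_neg]
    abel
end

section
/- A biquasigroup (Q,∘,*) satisfies the identity (x∘z)*(y∘z) = x∘y for all x, y, z ∈ Q if and only if there exist a group structure (Q,·) on Q and a bijection α : Q → Q such that x∘y = (α x)⁻¹ · (α y) and x*y = x · y⁻¹ for all x, y ∈ Q. -/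
/-- A biquasigroup `(Q,∘,*)` satisfies `(x∘z)*(y∘z) = x∘y` for all
`x,y,z` iff there exist a group structure `(Q,·)` on `Q` (given by a multiplication,
a unit and an inversion satisfying the group axioms) and a bijection `α : Q → Q`
such that `x∘y = (α x)⁻¹ · (α y)` and `x*y = x · y⁻¹` for all `x, y`. -/
theorem stmt_9 {Q : Type*} [Nonempty Q] (circ star : Q → Q → Q)
    (hcl : ∀ a : Q, Function.Bijective (fun x => circ a x))
    (hcr : ∀ a : Q, Function.Bijective (fun x => circ x a))
    (hsl : ∀ a : Q, Function.Bijective (fun x => star a x))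
    (hsr : ∀ a : Q, Function.Bijective (fun x => star x a)) :
    (∀ x y z, star (circ x z) (circ y z) = circ x y) ↔
      (∃ (mul : Q → Q → Q) (one : Q) (inv : Q → Q),
        (∀ x y z, mul (mul x y) z = mul x (mul y z)) ∧
        (∀ x, mul one x = x) ∧ (∀ x, mul x one = x) ∧
        (∀ x, mul (inv x) x = one) ∧ (∀ x, mul x (inv x) = one) ∧
        ∃ α : Q ≃ Q, (∀ x y, circ x y = mul (inv (α x)) (α y)) ∧
          (∀ x y, star x y = mul x (inv y))) := by
  constructor
  · intro h
    have ward : ∀ a b c, star (star a c) (star b c) = star a b := by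
      intro a b c
      obtain ⟨z⟩ := ‹Nonempty Q›
      obtain ⟨x, rfl⟩ := (hcr z).surjective a
      obtain ⟨y, rfl⟩ := (hcr z).surjective b
      obtain ⟨w, rfl⟩ := (hcr z).surjective c
      simp only [h]
    obtain ⟨p⟩ := ‹Nonempty Q›
    obtain ⟨e, he⟩ : ∃ e, e = star p p := ⟨_, rfl⟩
    have star_self : ∀ a, star a a = e := by
      intro a
      obtain ⟨c, rfl⟩ := (hsl p).surjective a
      simp only [ward, he]
    have circ_self : ∀ x, circ x x = e := fun x => by
      rw [← h x x x, star_self]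
    have star_e : ∀ a, star a e = a := by
      intro a
      obtain ⟨x, rfl⟩ := (hcr p).surjective a
      have := h x p p
      rwa [circ_self] at this
    have e_e_star : ∀ a, star e (star e a) = a := fun a => by
      have := ward a e a
      rwa [star_self, star_e] at this
    have e_star : ∀ a b, star e (star a b) = star b a := fun a b => by
      have := ward b a b
      rwa [star_self] at this
    refine ⟨fun x y => star x (star e y), e, star e, fun x y z => ?_, e_e_star,
      fun x => by simp only [star_e], fun x => star_self _,
      fun x => by simp only [e_e_star, star_self],
      Equiv.ofBijective (fun x => star e (circ x p)) ((hsl e).comp (hcr p)),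
      fun x y => ?_, fun x y => by simp only [e_e_star]⟩
    · have hk : star (star (star e z) y) (star e y) = star e z := by
        have := ward (star e z) e y
        rwa [star_e] at this
      calc star (star x (star e y)) (star e z)
          = star (star x (star e y)) (star (star (star e z) y) (star e y)) := by rw [hk]
        _ = star x (star (star e z) y) := ward _ _ _
        _ = star x (star e (star y (star e z))) := by rw [e_star]
    · simp only [Equiv.ofBijective_apply, e_e_star, h]
  · rintro ⟨mul, one, inv, assoc, one_mul', mul_one', inv_mul', mul_inv', α, hc, hs⟩ x y z
    have inv_eq : ∀ a b, mul a b = one → inv a = b := fun a b hab => by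
      rw [← mul_one' (inv a), ← hab, ← assoc, inv_mul', one_mul']
    have key : inv (mul (inv (α y)) (α z)) = mul (inv (α z)) (α y) := by
      apply inv_eq
      rw [assoc, ← assoc (α z), mul_inv', one_mul', inv_mul']
    rw [hs, hc x z, hc y z, hc x y, key, assoc, ← assoc (α z), mul_inv', one_mul']
end

section
/- Let (Q,+) be a group, let φ, ψ, α, β be automorphisms of (Q,+), and let a, b ∈ Q. Define x∘y = φ(x) + a + ψ(y) and x*y = α(x) + b + β(y). Then the identity (x∘z)*(y∘z) = x∘y holds for all x, y, z ∈ Q if and only if (Q,+) is commutative, ψ = −φ, α is the identity map, β(y) = −y for all y, and b = a (so that x∘y = φ(x) − φ(y) + a and x*y = x − y + a). -/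
/-- A biquasigroup linear over a group `(Q,+)` satisfies
`(x∘z)*(y∘z) = x∘y` iff `(Q,+)` is commutative, `ψ = -φ`, `α = id`, `β y = -y` and `b = a`. -/
theorem stmt_10 {Q : Type*} [AddGroup Q] (φ ψ α β : AddAut Q) (a b : Q)
    (circ star : Q → Q → Q)
    (hcirc : ∀ x y, circ x y = φ x + a + ψ y)
    (hstar : ∀ x y, star x y = α x + b + β y) :
    (∀ x y z, star (circ x z) (circ y z) = circ x y) ↔
      ((∀ x y : Q, x + y = y + x) ∧ (∀ y, ψ y = -(φ y)) ∧ (∀ x, α x = x) ∧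
        (∀ y, β y = -y) ∧ b = a) := by
  simp only [hcirc, hstar]
  constructor
  · intro h
    have h₀ : α a + b + β a = a := by simpa using h 0 0 0
    have hα : ∀ x, α x = x := by
      intro x
      have hx := h (φ.symm x) 0 0
      simp only [map_zero, map_add, AddEquiv.apply_symm_apply, zero_add, add_zero] at hx
      rw [add_assoc, add_assoc, ← add_assoc (α a), h₀] at hx
      exact add_right_cancel hx
    have hb : b = -β a := by
      rw [hα, add_assoc, add_eq_left] at h₀
      exact eq_neg_of_add_eq_zero_left h₀
    have hβ : ∀ y, β y = -y := by
      intro y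
      have hy := h 0 0 (ψ.symm y)
      simp only [map_zero, map_add, AddEquiv.apply_symm_apply, zero_add, add_zero, hα, hb] at hy
      rw [add_assoc, add_assoc, neg_add_cancel_left, add_eq_left] at hy
      exact eq_neg_of_add_eq_zero_right hy
    have hcomm : ∀ x y : Q, x + y = y + x := by
      intro x y
      have hxy := map_add β x y
      rw [hβ, hβ, hβ, ← neg_add_rev] at hxy
      exact neg_injective hxy
    have hba : b = a := by rw [hb, hβ, neg_neg]
    refine ⟨hcomm, fun y => ?_, hα, hβ, hba⟩
    have hy := h 0 y 0
    simp only [map_zero, zero_add, add_zero, hα, hβ, hba] at hy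
    rw [hcomm (φ y) a, neg_add_rev, hcomm (-φ y), add_assoc, add_neg_cancel_left] at hy
    exact (add_left_cancel hy).symm
  · rintro ⟨hcomm, hψ, hα, hβ, rfl⟩ x y z
    let _ : AddCommGroup Q := { ‹AddGroup Q› with add_comm := hcomm }
    rw [hψ, hψ, hα, hβ]
    abel
end

section
/- Let (Q,∘,*) be a biquasigroup satisfying the identity (x∘z)∘(y*z) = x*y for all x, y, z ∈ Q, in which the operation ∘ is medial and the operation * is idempotent. Then * is medial too, and there exist a commutative group structure (Q,+) on Q and commuting automorphisms φ, ψ of (Q,+) such that φ(x) + φ(ψ(x)) + ψ(x) = 0 and φ(φ(x)) = φ(x) + x for all x ∈ Q, with x∘y = φ(x) + ψ(y) and x*y = φ(φ(x)) − φ(y) for all x, y ∈ Q. -/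
/-- Toyoda's theorem for a medial quasigroup with an idempotent `e`: the operation is
`φ x + ψ y` for commuting automorphisms `φ`, `ψ` of an abelian group structure. -/
theorem exists_addCommGroup_of_medial_of_idempotent {Q : Type*} (op : Q → Q → Q)
    (hl : ∀ a : Q, Function.Bijective (fun x => op a x))
    (hr : ∀ a : Q, Function.Bijective (fun x => op x a))
    (hmed : ∀ x y z w, op (op x y) (op z w) = op (op x z) (op y w))
    (e : Q) (he : op e e = e) :
    ∃ (_ : AddCommGroup Q) (φ ψ : Q ≃+ Q),
      (∀ x, φ (ψ x) = ψ (φ x)) ∧ ∀ x y, op x y = φ x + ψ y := by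
  let R : Q ≃ Q := Equiv.ofBijective _ (hr e)
  let L : Q ≃ Q := Equiv.ofBijective _ (hl e)
  have R_apply (x) : R x = op x e := rfl
  have L_apply (x) : L x = op e x := rfl
  have R_op (x y) : R (op x y) = op (R x) (R y) := by
    simpa only [R_apply, he] using hmed x y e e
  have L_op (x y) : L (op x y) = op (L x) (L y) := by
    simpa only [L_apply, he] using hmed e e x y
  have R_L (x) : R (L x) = L (R x) := by
    simpa only [R_apply, L_apply, he] using hmed e x e e
  have R_symm_op (x y) : R.symm (op x y) = op (R.symm x) (R.symm y) := by
    rw [Equiv.symm_apply_eq, R_op, R.apply_symm_apply, R.apply_symm_apply]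
  have L_symm_op (x y) : L.symm (op x y) = op (L.symm x) (L.symm y) := by
    rw [Equiv.symm_apply_eq, L_op, L.apply_symm_apply, L.apply_symm_apply]
  have R_symm_L (x) : R.symm (L x) = L (R.symm x) := by
    rw [Equiv.symm_apply_eq, R_L, R.apply_symm_apply]
  have L_symm_R (x) : L.symm (R x) = R (L.symm x) := by
    rw [Equiv.symm_apply_eq, ← R_L, L.apply_symm_apply]
  have R_symm_L_symm (x) : R.symm (L.symm x) = L.symm (R.symm x) := by
    rw [Equiv.symm_apply_eq, ← L_symm_R, R.apply_symm_apply]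
  have R_symm_e : R.symm e = e := by rw [Equiv.symm_apply_eq, R_apply, he]
  have L_symm_e : L.symm e = e := by rw [Equiv.symm_apply_eq, L_apply, he]
  let add : Q → Q → Q := fun x y => op (R.symm x) (L.symm y)
  have e_add (x) : add e x = x := by
    simp only [add, R_symm_e, ← L_apply, L.apply_symm_apply]
  have add_e (x) : add x e = x := by
    simp only [add, L_symm_e, ← R_apply, R.apply_symm_apply]
  have add_medial (a b c d) : add (add a b) (add c d) = add (add a c) (add b d) := by
    simp only [add, R_symm_op, L_symm_op, R_symm_L_symm]
    exact hmed _ _ _ _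
  have add_comm' (a b) : add a b = add b a := by
    simpa only [e_add, add_e] using add_medial e a b e
  have add_assoc' (a b c) : add (add a b) c = add a (add b c) := by
    simpa only [e_add, add_e] using add_medial a b e c
  have exists_neg (x) : ∃ y, add y x = e := by
    obtain ⟨a, ha⟩ := (hr (L.symm x)).surjective e
    exact ⟨R a, by simpa only [add, R.symm_apply_apply] using ha⟩
  choose neg neg_add using exists_neg
  let G : AddCommGroup Q :=
    { add := add
      zero := e
      neg := neg
      nsmul := @nsmulRec Q ⟨e⟩ ⟨add⟩
      zsmul := @zsmulRec Q ⟨e⟩ ⟨add⟩ ⟨neg⟩ (@nsmulRec Q ⟨e⟩ ⟨add⟩)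
      add_assoc := add_assoc'
      zero_add := e_add
      add_zero := add_e
      add_comm := add_comm'
      neg_add_cancel := neg_add }
  have add_def (x y : Q) : x + y = op (R.symm x) (L.symm y) := rfl
  refine ⟨G, { R with map_add' := fun x y => ?_ }, { L with map_add' := fun x y => ?_ },
    R_L, fun x y => ?_⟩
  · change R (x + y) = R x + R y
    rw [add_def, add_def, R_op, L_symm_R, R.symm_apply_apply, R.apply_symm_apply]
  · change L (x + y) = L x + L y
    rw [add_def, add_def, L_op, R_symm_L, L.symm_apply_apply, L.apply_symm_apply]
  · change op x y = R x + L y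
    rw [add_def, R.symm_apply_apply, L.symm_apply_apply]


/-- Let `(Q,∘,*)` be a biquasigroup satisfying `(x∘z)∘(y*z) = x*y`, with
`∘` medial and `*` idempotent. Then `*` is medial too, and there exist a commutative
group structure `(Q,+)` on `Q` (given by `add`, `zero`, `neg` satisfying the abelian
group axioms) and commuting automorphisms `φ, ψ` such that
`φ x + φ(ψ x) + ψ x = 0`, `φ(φ x) = φ x + x`, `x∘y = φ x + ψ y` and
`x*y = φ(φ x) - φ y`. -/
theorem stmt_11 {Q : Type*} [Nonempty Q] (circ star : Q → Q → Q)
    (hcl : ∀ a : Q, Function.Bijective (fun x => circ a x))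
    (hcr : ∀ a : Q, Function.Bijective (fun x => circ x a))
    (hsl : ∀ a : Q, Function.Bijective (fun x => star a x))
    (hsr : ∀ a : Q, Function.Bijective (fun x => star x a))
    (hid : ∀ x y z, circ (circ x z) (star y z) = star x y)
    (hmed : ∀ x y z w, circ (circ x y) (circ z w) = circ (circ x z) (circ y w))
    (hidem : ∀ x, star x x = x) :
    (∀ x y z w, star (star x y) (star z w) = star (star x z) (star y w)) ∧
    ∃ (add : Q → Q → Q) (zero : Q) (neg : Q → Q),
      (∀ x y z, add (add x y) z = add x (add y z)) ∧
      (∀ x y, add x y = add y x) ∧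
      (∀ x, add zero x = x) ∧
      (∀ x, add (neg x) x = zero) ∧
      ∃ φ ψ : Q → Q,
        Function.Bijective φ ∧ Function.Bijective ψ ∧
        (∀ x y, φ (add x y) = add (φ x) (φ y)) ∧
        (∀ x y, ψ (add x y) = add (ψ x) (ψ y)) ∧
        (∀ x, φ (ψ x) = ψ (φ x)) ∧
        (∀ x, add (add (φ x) (φ (ψ x))) (ψ x) = zero) ∧
        (∀ x, φ (φ x) = add (φ x) x) ∧
        (∀ x y, circ x y = add (φ x) (ψ y)) ∧
        (∀ x y, star x y = add (φ (φ x)) (neg (φ y))) := by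
  have circ_self (x) : circ x x = x := by
    have h₁ : circ (circ x x) x = x := by simpa only [hidem] using hid x x x
    have h₂ : star (circ x x) x = circ x x := by
      simpa only [h₁, hidem] using (hid (circ x x) x x).symm
    exact ((hsl (circ x x)).injective (h₂.trans (hidem _).symm)).symm
  obtain ⟨e⟩ := ‹Nonempty Q›
  obtain ⟨_, φ, ψ, φ_ψ, circ_eq⟩ :=
    exists_addCommGroup_of_medial_of_idempotent circ hcl hcr hmed e (circ_self e)
  have star_eq' (x y) : star x y = φ (φ x) + φ (ψ y) + ψ y := by
    rw [← hid x y y, hidem, circ_eq, circ_eq, map_add]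
  have ψ_eq (x) : ψ x = x - φ x := by
    rw [eq_sub_iff_add_eq', ← circ_eq, circ_self]
  have φ_φ (x) : φ (φ x) = φ x + x := by
    have h := hid 0 0 x
    rw [circ_eq, circ_eq, hidem, star_eq'] at h
    simp only [map_zero, zero_add, φ_ψ, ← map_add] at h
    rw [EmbeddingLike.map_eq_zero_iff, ψ_eq, map_add] at h
    rw [← sub_eq_zero, ← neg_eq_zero, ← h]
    abel
  have star_eq (x y) : star x y = φ (φ x) + -φ y := by
    rw [star_eq', ψ_eq, map_sub, φ_φ y]
    abel
  refine ⟨fun x y z w => ?_, (· + ·), 0, (- ·), add_assoc, add_comm, zero_add,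
    neg_add_cancel, φ, ψ, φ.bijective, ψ.bijective, map_add φ, map_add ψ, φ_ψ,
    fun x => ?_, φ_φ, circ_eq, star_eq⟩
  · simp only [star_eq, map_add, map_neg]
    abel
  · simp only [ψ_eq, map_sub, φ_φ]
    abel
end

section
/- Let (Q,+) be a commutative group and let φ, ψ be commuting automorphisms of (Q,+) such that φ(x) + φ(ψ(x)) + ψ(x) = 0 and φ(φ(x)) = φ(x) + x for all x ∈ Q. Define x∘y = φ(x) + ψ(y) and x*y = φ(φ(x)) − φ(y). Then ∘ and * are quasigroup operations on Q, both are medial, and the identity (x∘z)∘(y*z) = x*y holds for all x, y, z ∈ Q. -/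
/-- Let `(Q,+)` be a commutative group with commuting automorphisms
`φ, ψ` such that `φ x + φ(ψ x) + ψ x = 0` and `φ(φ x) = φ x + x` for all `x`. Define
`x∘y = φ x + ψ y` and `x*y = φ(φ x) - φ y`. Then `∘` and `*` are quasigroup operations,
both are medial, and `(x∘z)∘(y*z) = x*y` holds for all `x,y,z`. -/
theorem stmt_12 {Q : Type*} [AddCommGroup Q] (φ ψ : AddAut Q)
    (hcomm : ∀ x, φ (ψ x) = ψ (φ x))
    (h1 : ∀ x, φ x + φ (ψ x) + ψ x = 0)
    (h2 : ∀ x, φ (φ x) = φ x + x)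
    (circ star : Q → Q → Q)
    (hcirc : ∀ x y, circ x y = φ x + ψ y)
    (hstar : ∀ x y, star x y = φ (φ x) - φ y) :
    ((∀ a : Q, Function.Bijective (fun x => circ a x)) ∧
      (∀ a : Q, Function.Bijective (fun x => circ x a)) ∧
      (∀ a : Q, Function.Bijective (fun x => star a x)) ∧
      (∀ a : Q, Function.Bijective (fun x => star x a))) ∧
    (∀ x y z w, circ (circ x y) (circ z w) = circ (circ x z) (circ y w)) ∧
    (∀ x y z w, star (star x y) (star z w) = star (star x z) (star y w)) ∧
    (∀ x y z, circ (circ x z) (star y z) = star x y) := by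
  obtain rfl : circ = fun x y => φ x + ψ y := funext₂ hcirc
  obtain rfl : star = fun x y => φ (φ x) - φ y := funext₂ hstar
  refine ⟨⟨fun a => ?_, fun a => ?_, fun a => ?_, fun a => ?_⟩, fun x y z w => ?_,
    fun x y z w => ?_, fun x y z => ?_⟩
  · exact (Equiv.addLeft (φ a)).bijective.comp ψ.bijective
  · exact (Equiv.addRight (ψ a)).bijective.comp φ.bijective
  · exact (Equiv.subLeft (φ (φ a))).bijective.comp φ.bijective
  · exact (Equiv.subRight (φ a)).bijective.comp (φ.bijective.comp φ.bijective)
  · simp only [map_add, hcomm]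
    abel
  · simp only [map_sub]
    abel
  · have key : ψ (φ (φ y)) = -φ y := by
      rw [h2, map_add, ← hcomm, eq_neg_iff_add_eq_zero, ← h1 y]
      abel
    simp only [map_add, map_sub, key, hcomm]
    abel
end

section
/- Let a ≥ 3 be an integer and let n = a² − a − 1. On Z_n (the integers modulo n) define x∘y = a·x + (1−a)·y and x*y = (a+1)·x − a·y. Then ∘ and * are quasigroup operations on Z_n, both are idempotent and medial, and the identity (x∘z)∘(y*z) = x*y holds for all x, y, z ∈ Z_n. -/
theorem bijective_of_eq_mul_add {R : Type*} [CommRing R] {u v t : R} (huv : u * v = 1)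
    {f : R → R} (hf : ∀ x, f x = u * x + t) : Function.Bijective f := by
  refine Function.bijective_iff_has_inverse.2 ⟨fun y => v * (y - t), fun x => ?_, fun y => ?_⟩
  · simp only [hf]
    linear_combination x * huv
  · simp only [hf]
    linear_combination (y - t) * huv

theorem ZMod.natCast_sq_eq_add_one {a n : ℕ} (ha : 2 ≤ a) (hn : n = a ^ 2 - a - 1) :
    (a : ZMod n) ^ 2 = a + 1 := by
  have h : a ^ 2 = n + a + 1 := by
    have : a + 1 ≤ a ^ 2 := by nlinarith
    omega
  simpa using congrArg (Nat.cast : ℕ → ZMod n) h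

/-- For an integer `a ≥ 3` and `n = a² - a - 1`, the operations
`x∘y = a·x + (1-a)·y` and `x*y = (a+1)·x - a·y` on `ℤ/nℤ` are idempotent medial
quasigroup operations satisfying `(x∘z)∘(y∘z)... (x∘z)∘(y*z) = x*y`. -/
theorem stmt_13 (a : ℕ) (ha : 3 ≤ a) (n : ℕ) (hn : n = a ^ 2 - a - 1)
    (circ star : ZMod n → ZMod n → ZMod n)
    (hcirc : ∀ x y, circ x y = (a : ZMod n) * x + (1 - (a : ZMod n)) * y)
    (hstar : ∀ x y, star x y = ((a : ZMod n) + 1) * x - (a : ZMod n) * y) :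
    ((∀ c : ZMod n, Function.Bijective (fun x => circ c x)) ∧
      (∀ c : ZMod n, Function.Bijective (fun x => circ x c)) ∧
      (∀ c : ZMod n, Function.Bijective (fun x => star c x)) ∧
      (∀ c : ZMod n, Function.Bijective (fun x => star x c))) ∧
    (∀ x, circ x x = x) ∧ (∀ x, star x x = x) ∧
    (∀ x y z w, circ (circ x y) (circ z w) = circ (circ x z) (circ y w)) ∧
    (∀ x y z w, star (star x y) (star z w) = star (star x z) (star y w)) ∧
    (∀ x y z, circ (circ x z) (star y z) = star x y) := by
  have hsq : (a : ZMod n) ^ 2 = a + 1 := ZMod.natCast_sq_eq_add_one (by omega) hn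
  refine ⟨⟨fun c => ?_, fun c => ?_, fun c => ?_, fun c => ?_⟩, ?_, ?_, ?_, ?_, ?_⟩
  · refine bijective_of_eq_mul_add (u := 1 - (a : ZMod n)) (v := -a) (t := a * c) ?_ fun x => ?_
    · linear_combination hsq
    · rw [hcirc]; ring
  · refine bijective_of_eq_mul_add (u := (a : ZMod n)) (v := a - 1) (t := (1 - a) * c) ?_ fun x => ?_
    · linear_combination hsq
    · rw [hcirc]
  · refine bijective_of_eq_mul_add (u := -(a : ZMod n)) (v := 1 - a) (t := (a + 1) * c) ?_ fun x => ?_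
    · linear_combination hsq
    · rw [hstar]; ring
  · refine bijective_of_eq_mul_add (u := (a : ZMod n) + 1) (v := 2 - a) (t := -(a * c)) ?_ fun x => ?_
    · linear_combination -hsq
    · rw [hstar]; ring
  · intro x; rw [hcirc]; ring
  · intro x; rw [hstar]; ring
  · intro x y z w; simp only [hcirc]; ring
  · intro x y z w; simp only [hstar]; ring
  · intro x y z
    simp only [hcirc, hstar]
    linear_combination (x - y) * hsq
end

section
/- Let (Q,+) be a group, let φ, ψ, α, β be automorphisms of (Q,+), and let a, b ∈ Q. Define x∘y = φ(x) + a + ψ(y) and x*y = α(x) + b + β(y). Then the identity (x∘z)∘(y*z) = x*y holds for all x, y, z ∈ Q if and only if (Q,+) is commutative, α = φ², β = ψ∘φ², φ(ψ(z)) + ψ(ψ(φ(φ(z)))) = 0 for all z ∈ Q, and φ(a) + a + ψ(b) = b (so that x∘y = φ(x) + ψ(y) + a and x*y = φ²(x) + ψ(φ²(y)) + b). -/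
/-- A biquasigroup linear over a group `(Q,+)` satisfies
`(x∘z)∘(y*z) = x*y` iff `(Q,+)` is commutative, `α = φ²`, `β = ψ ∘ φ²`,
`φ(ψ z) + ψ(ψ(φ(φ z))) = 0` for all `z`, and `φ a + a + ψ b = b`. -/
theorem stmt_14 {Q : Type*} [AddGroup Q] (φ ψ α β : AddAut Q) (a b : Q)
    (circ star : Q → Q → Q)
    (hcirc : ∀ x y, circ x y = φ x + a + ψ y)
    (hstar : ∀ x y, star x y = α x + b + β y) :
    (∀ x y z, circ (circ x z) (star y z) = star x y) ↔
      ((∀ x y : Q, x + y = y + x) ∧ (∀ x, α x = φ (φ x)) ∧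
        (∀ x, β x = ψ (φ (φ x))) ∧
        (∀ z, φ (ψ z) + ψ (ψ (φ (φ z))) = 0) ∧ φ a + a + ψ b = b) := by
  simp only [hcirc, hstar, map_add]
  constructor
  · intro h
    have hconst : φ a + a + ψ b = b := by simpa using h 0 0 0
    have hα : ∀ x, α x = φ (φ x) := fun x => by
      have hx := h x 0 0
      simp only [map_zero, add_zero, zero_add] at hx
      rw [add_assoc, add_assoc, ← add_assoc (φ a), hconst] at hx
      exact (add_right_cancel hx).symm
    have hcancel : ∀ y z,
        φ (ψ z) + (a + ψ (α y) + ψ b) + ψ (β z) = a + ψ (α y) + ψ b := fun y z => by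
      have hz := (h 0 y z).trans (h 0 y 0).symm
      simpa [add_assoc] using hz
    have hconj : ∀ w z, φ (ψ z) + w + ψ (β z) = w := fun w z => by
      have hy := hcancel (α.symm (ψ.symm (-a + w + -ψ b))) z
      have hw : a + ψ (α (α.symm (ψ.symm (-a + w + -ψ b)))) + ψ b = w := by
        simp [add_assoc]
      rwa [hw] at hy
    have hneg : ∀ z, φ (ψ z) + ψ (β z) = 0 := fun z => by simpa using hconj 0 z
    have hcomm : ∀ x y : Q, x + y = y + x := fun x y => by
      have hy := hconj y (ψ.symm (φ.symm x))
      rw [← neg_eq_of_add_eq_zero_right (hneg _)] at hy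
      simpa [← sub_eq_add_neg, sub_eq_iff_eq_add] using hy
    have hβ : ∀ y, β y = ψ (φ (φ y)) := fun y => by
      have hy := h 0 y 0
      simp only [map_zero, add_zero, zero_add] at hy
      rw [hcomm (ψ (α y)), ← add_assoc, hconst, hα] at hy
      exact (add_left_cancel hy).symm
    exact ⟨hcomm, hα, hβ, fun z => by rw [← hβ]; exact hneg z, hconst⟩
  · rintro ⟨hcomm, hα, hβ, hz, hconst⟩ x y z
    have : Std.Commutative (α := Q) (· + ·) := ⟨hcomm⟩
    simp only [hα, hβ]
    calc _ = φ (φ x) + (φ a + a + ψ b) + ψ (φ (φ y)) +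
          (φ (ψ z) + ψ (ψ (φ (φ z)))) := by ac_rfl
      _ = _ := by rw [hz, hconst, add_zero]
end

section
/- Let (Q,∘,*) be a biquasigroup satisfying the identity (x∘z)*(y*z) = x∘y for all x, y, z ∈ Q. Then: (i) if e ∈ Q satisfies e*e = e, then x*e = x for all x ∈ Q, and e is the unique idempotent of * (any a with a*a = a equals e); (ii) if there is u ∈ Q with x∘x = u for all x ∈ Q, then there is w ∈ Q with x*x = w for all x ∈ Q, and moreover x∘y = u*(y*x) for all x, y ∈ Q and w∘u = w. -/
/-- Let `(Q,∘,*)` be a biquasigroup satisfying `(x∘z)*(y*z) = x∘y`.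
(i) Any idempotent `e` of `*` is a right neutral element of `*` and is the unique
idempotent of `*`. (ii) If `∘` is unipotent with value `u`, then `*` is unipotent with
some value `w`, `x∘y = u*(y*x)` for all `x,y`, and `w∘u = w`. -/
theorem stmt_15 {Q : Type*} [Nonempty Q] (circ star : Q → Q → Q)
    (hcl : ∀ a : Q, Function.Bijective (fun x => circ a x))
    (hcr : ∀ a : Q, Function.Bijective (fun x => circ x a))
    (hsl : ∀ a : Q, Function.Bijective (fun x => star a x))
    (hsr : ∀ a : Q, Function.Bijective (fun x => star x a))
    (hid : ∀ x y z, star (circ x z) (star y z) = circ x y) :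
    (∀ e : Q, star e e = e → (∀ x, star x e = x) ∧ (∀ a, star a a = a → a = e)) ∧
    (∀ u : Q, (∀ x, circ x x = u) →
      ∃ w : Q, (∀ x, star x x = w) ∧ (∀ x y, circ x y = star u (star y x)) ∧
        circ w u = w) := by
  refine ⟨fun e he => ?_, fun u hu => ?_⟩
  · have right_neutral : ∀ x, star x e = x := by
      intro x
      obtain ⟨t, rfl⟩ := (hcr e).2 x
      simpa only [he] using hid t e e
    refine ⟨right_neutral, fun a ha => (hsl a).1 ?_⟩
    exact ha.trans (right_neutral a).symm
  · have circ_eq : ∀ x y, circ x y = star u (star y x) := by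
      intro x y
      rw [← hid x y x, hu]
    have star_self : ∀ x, star x x = star u u := by
      intro x
      apply (hsl u).1
      change star u (star x x) = star u (star u u)
      rw [← circ_eq, ← circ_eq, hu, hu]
    refine ⟨star u u, star_self, circ_eq, ?_⟩
    rw [circ_eq, ← circ_eq u u, hu]
end

section
/- Let (Q,+) be a group, let φ, ψ, α, β be automorphisms of (Q,+), and let a, b ∈ Q. Define x∘y = φ(x) + a + ψ(y) and x*y = α(x) + b + β(y). Then the identity (x∘z)*(y*z) = x∘y holds for all x, y, z ∈ Q if and only if (Q,+) is commutative, ψ(y) = −y for all y, α is the identity map, and β(y) = −y for all y (so that x∘y = φ(x) − y + a and x*y = x − y + b). -/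
/-- A biquasigroup linear over a group `(Q,+)` satisfies
`(x∘z)*(y*z) = x∘y` iff `(Q,+)` is commutative, `ψ y = -y`, `α = id` and `β y = -y`. -/
theorem stmt_16 {Q : Type*} [AddGroup Q] (φ ψ α β : AddAut Q) (a b : Q)
    (circ star : Q → Q → Q)
    (hcirc : ∀ x y, circ x y = φ x + a + ψ y)
    (hstar : ∀ x y, star x y = α x + b + β y) :
    (∀ x y z, star (circ x z) (star y z) = circ x y) ↔
      ((∀ x y : Q, x + y = y + x) ∧ (∀ y, ψ y = -y) ∧ (∀ x, α x = x) ∧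
        (∀ y, β y = -y)) := by
  constructor
  · intro h
    simp only [hcirc, hstar, map_add] at h
    have h0 : α a + b + β b = a := by simpa [add_assoc] using h 0 0 0
    have hα (x : Q) : α x = x := by
      obtain ⟨u, rfl⟩ := φ.surjective x
      have hu : α (φ u) + (α a + b + β b) = φ u + a := by
        simpa [add_assoc] using h u 0 0
      rw [h0] at hu
      exact add_right_cancel hu
    have hb : b + β b = 0 := by simpa [hα, add_assoc] using h0
    have hβb : β b = -b := (neg_eq_of_add_eq_zero_right hb).symm
    have hmain (y z : Q) : ψ z + (b + β y - b) + β (β z) = ψ y := by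
      have hyz := h 0 y z
      simp only [hα, hβb, map_zero, zero_add, add_assoc, add_right_inj] at hyz
      simpa only [sub_eq_add_neg, add_assoc] using hyz
    have hconj (y : Q) : b + β y - b = ψ y := by simpa using hmain y 0
    simp only [hconj] at hmain
    have hββ (z : Q) : ψ z + β (β z) = 0 := by simpa using hmain 0 z
    have hcomm (x y : Q) : x + y = y + x := by
      obtain ⟨z, rfl⟩ := ψ.surjective x
      obtain ⟨w, rfl⟩ := ψ.surjective y
      have hw := hmain w z
      rw [← neg_eq_of_add_eq_zero_right (hββ z), ← sub_eq_add_neg, sub_eq_iff_eq_add] at hw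
      exact hw
    have hψβ (y : Q) : ψ y = β y := by rw [← hconj, hcomm b, add_sub_cancel_right]
    have hβ (y : Q) : β y = -y := by
      apply β.injective
      rw [map_neg]
      exact (neg_eq_of_add_eq_zero_right (hψβ y ▸ hββ y)).symm
    exact ⟨hcomm, fun y => (hψβ y).trans (hβ y), hα, hβ⟩
  · rintro ⟨hcomm, hψ, hα, hβ⟩ x y z
    simp only [hcirc, hstar, hψ, hα, hβ]
    generalize φ x = u
    let _ : AddCommGroup Q := { ‹AddGroup Q› with add_comm := hcomm }
    abel
end

section
/- Let (Q,∘,*) be a biquasigroup satisfying the identity (x∘z)*(y*z) = x*y for all x, y, z ∈ Q. Then: (i) for a ∈ Q, a∘a = a holds if and only if a*a = a; (ii) if a∘a = a, then a is a common right neutral element of both operations, i.e. x∘a = x and x*a = x for all x ∈ Q; (iii) each operation has at most one idempotent: if a∘a = a and c∘c = c then a = c, and if a*a = a and c*c = c then a = c. -/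
/-- Let `(Q,∘,*)` be a biquasigroup satisfying `(x∘z)*(y*z) = x*y`.
(i) `a∘a = a ↔ a*a = a`; (ii) any idempotent `a` of `∘` is a common right neutral
element of both operations; (iii) each operation has at most one idempotent. -/
theorem stmt_17 {Q : Type*} [Nonempty Q] (circ star : Q → Q → Q)
    (hcl : ∀ a : Q, Function.Bijective (fun x => circ a x))
    (hcr : ∀ a : Q, Function.Bijective (fun x => circ x a))
    (hsl : ∀ a : Q, Function.Bijective (fun x => star a x))
    (hsr : ∀ a : Q, Function.Bijective (fun x => star x a))
    (hid : ∀ x y z, star (circ x z) (star y z) = star x y) :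
    (∀ a : Q, circ a a = a ↔ star a a = a) ∧
    (∀ a : Q, circ a a = a → ∀ x, circ x a = x ∧ star x a = x) ∧
    (∀ a c : Q, circ a a = a → circ c c = c → a = c) ∧
    (∀ a c : Q, star a a = a → star c c = c → a = c) := by
  have star_right : ∀ a, circ a a = a → ∀ y, star y a = y := fun a ha y =>
    (hsl a).1 (by simpa only [ha] using hid a y a)
  have circ_right : ∀ a, circ a a = a → ∀ x, circ x a = x := fun a ha x =>
    (hsr a).1 (by simpa only [star_right a ha a] using hid x a a)
  have circ_of_star : ∀ a, star a a = a → circ a a = a := fun a ha =>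
    (hsr a).1 (by simpa only [ha] using hid a a a)
  have unique : ∀ a c, circ a a = a → circ c c = c → a = c := fun a c ha hc =>
    (hcl a).1 (ha.trans (circ_right c hc a).symm)
  exact ⟨fun a => ⟨fun ha => star_right a ha a, circ_of_star a⟩,
    fun a ha x => ⟨circ_right a ha x, star_right a ha x⟩, unique,
    fun a c ha hc => unique a c (circ_of_star a ha) (circ_of_star c hc)⟩
end

section
/- Let (Q,∘,*) be a biquasigroup satisfying the identity (x∘z)*(y*z) = x*y for all x, y, z ∈ Q, and suppose the operation * is unipotent, i.e. there is w ∈ Q with x*x = w for all x ∈ Q. Then the two operations coincide, x∘y = x*y for all x, y ∈ Q, and (Q,∘) is a Ward quasigroup, i.e. (x∘z)∘(y∘z) = x∘y for all x, y, z ∈ Q. -/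
/-- If a biquasigroup `(Q,∘,*)` satisfies `(x∘z)*(y*z) = x*y` and `*` is
unipotent, then the operations coincide and `(Q,∘)` is a Ward quasigroup. -/
theorem stmt_18 {Q : Type*} [Nonempty Q] (circ star : Q → Q → Q)
    (hcl : ∀ a : Q, Function.Bijective (fun x => circ a x))
    (hcr : ∀ a : Q, Function.Bijective (fun x => circ x a))
    (hsl : ∀ a : Q, Function.Bijective (fun x => star a x))
    (hsr : ∀ a : Q, Function.Bijective (fun x => star x a))
    (hid : ∀ x y z, star (circ x z) (star y z) = star x y)
    (w : Q) (huni : ∀ x, star x x = w) :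
    (∀ x y, circ x y = star x y) ∧
    (∀ x y z, circ (circ x z) (circ y z) = circ x y) := by
  have h : ∀ x y, circ x y = star x y := fun x y =>
    (hsr (star x y)).injective <| by
      simp only [hid, huni]
  exact ⟨h, fun x y z => by simpa only [h] using hid x y z⟩
end

section
/- Let (Q,+) be a group, let φ, ψ, α, β be automorphisms of (Q,+), and let a, b ∈ Q. Define x∘y = φ(x) + a + ψ(y) and x*y = α(x) + b + β(y). Then the identity (x∘z)*(y*z) = x*y holds for all x, y, z ∈ Q if and only if (Q,+) is commutative, φ and α are the identity map, ψ(y) = −β(β(y)) for all y, and a = −β(b) (so that x∘y = x − β(β(y)) − β(b) and x*y = x + β(y) + b). -/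
/-- A biquasigroup linear over a group `(Q,+)` satisfies
`(x∘z)*(y*z) = x*y` iff `(Q,+)` is commutative, `φ = α = id`, `ψ y = -β(β y)` and
`a = -β b`. -/
theorem stmt_19 {Q : Type*} [AddGroup Q] (φ ψ α β : AddAut Q) (a b : Q)
    (circ star : Q → Q → Q)
    (hcirc : ∀ x y, circ x y = φ x + a + ψ y)
    (hstar : ∀ x y, star x y = α x + b + β y) :
    (∀ x y z, star (circ x z) (star y z) = star x y) ↔
      ((∀ x y : Q, x + y = y + x) ∧ (∀ x, φ x = x) ∧ (∀ x, α x = x) ∧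
        (∀ y, ψ y = -(β (β y))) ∧ a = -(β b)) := by
  simp only [hcirc, hstar, map_add]
  constructor
  · intro h
    have h_const : α a + b + β b = b := by simpa using h 0 0 0
    have hφ : ∀ x, φ x = x := fun x => by
      have hx := h x 0 0
      simp only [map_zero, add_zero, zero_add] at hx
      rw [add_assoc (α (φ x)), add_assoc (α (φ x)), h_const] at hx
      exact α.injective (add_right_cancel hx)
    have hαa : α a = b - β b - b := by
      rw [eq_sub_iff_add_eq, eq_sub_iff_add_eq, h_const]
    have hβα : ∀ y, β (α y) = β b + β y - β b := fun y => by
      have hy := h 0 y 0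
      simp only [map_zero, add_zero, zero_add, hαa, sub_add_cancel] at hy
      rw [eq_sub_iff_add_eq, ← add_right_inj (b - β b), hy]
      simp [sub_eq_add_neg, add_assoc]
    have hαψ : ∀ z, α a + α (ψ z) = b - β (β z) - β b - b := fun z => by
      have hz := h 0 0 z
      simp only [map_zero, add_zero, zero_add] at hz
      rw [eq_sub_iff_add_eq, eq_sub_iff_add_eq, eq_sub_iff_add_eq]
      simpa only [add_assoc] using hz
    have hββ : ∀ y z, β y + β (β z) = β (β z) + β y := fun y z => by
      have hyz := h 0 y z
      simp only [map_zero, zero_add, hαψ, hβα] at hyz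
      simp only [sub_eq_add_neg, add_assoc, neg_add_cancel_left, add_right_inj] at hyz
      exact neg_add_eq_iff_eq_add.mp hyz
    have h_comm : ∀ x y : Q, x + y = y + x := fun x y => by
      obtain ⟨u, rfl⟩ := β.surjective x
      obtain ⟨v, rfl⟩ := β.surjective y
      obtain ⟨w, rfl⟩ := β.surjective v
      exact hββ u w
    have hα : ∀ x, α x = x := fun x => β.injective (by
      rw [hβα, h_comm (β b), add_sub_cancel_right])
    have ha : a = -β b := by
      rw [← hα a, hαa, sub_eq_add_neg b, h_comm b, add_sub_cancel_right]
    refine ⟨h_comm, hφ, hα, fun y => ?_, ha⟩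
    have hy := hαψ y
    rw [hα, hα, ha, h_comm, sub_eq_add_neg b, h_comm b, sub_eq_add_neg _ b,
      sub_eq_add_neg _ (β b), add_assoc, h_comm (-β b), ← add_assoc,
      add_neg_cancel_right] at hy
    exact add_right_cancel hy
  · rintro ⟨h_comm, hφ, hα, hψ, rfl⟩ x y z
    let _ : AddCommGroup Q := { ‹AddGroup Q› with add_comm := h_comm }
    simp only [hφ, hα, hψ]
    abel
end
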